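/- arXiv:1904.04860 — 8 statements merged into one kernel-verified Lean document; each statement's English description precedes it below -/
import Mathlib

section
/- For all real numbers τ ≥ 1 and ε > 0, min( τ^{-(1+ε)} - (1+ε)/τ + ε , τ^{1+ε} - (1+ε)·τ + ε ) ≥ (ε/2)·(1 - 1/τ)². -/
theorem Real.log_le_half_sub_inv {t : ℝ} (ht : 1 ≤ t) : Real.log t ≤ (t - t⁻¹) / 2 := by
  rw [← Real.sinh_log (by linarith)]
  exact Real.self_le_sinh_iff.mpr (Real.log_nonneg ht)

theorem Real.add_sq_div_two_le_neg_log_one_sub {y : ℝ} (hy₀ : 0 ≤ y) (hy₁ : y < 1) :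
    y + y ^ 2 / 2 ≤ -Real.log (1 - y) := by
  have h := sum_le_hasSum (Finset.range 2) (fun i _ => by positivity)
    (Real.hasSum_pow_div_log_of_abs_lt_one (abs_lt.mpr ⟨by linarith, hy₁⟩))
  norm_num [Finset.sum_range_succ] at h
  linarith

theorem Real.mul_mul_log_sub_add_one_le_rpow_one_add {x : ℝ} (hx : 0 < x) (ε : ℝ) :
    ε * (x * Real.log x - x + 1) ≤ x ^ (1 + ε) - (1 + ε) * x + ε := by
  have h := Real.add_one_le_exp (Real.log x * ε)
  rw [← Real.rpow_def_of_pos hx] at h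
  rw [Real.rpow_add hx, Real.rpow_one]
  nlinarith [mul_le_mul_of_nonneg_left h hx.le]

theorem stmt0 (τ ε : ℝ) (hτ : 1 ≤ τ) (hε : 0 < ε) :
    min (τ ^ (-(1 + ε)) - (1 + ε) / τ + ε) (τ ^ (1 + ε) - (1 + ε) * τ + ε)
      ≥ ε / 2 * (1 - 1 / τ) ^ 2 := by
  have hτ₀ : 0 < τ := by linarith
  have hx₀ : 0 < τ⁻¹ := inv_pos.mpr hτ₀
  have hx₁ : τ⁻¹ ≤ 1 := inv_le_one_of_one_le₀ hτ
  have hmul : τ * τ⁻¹ = 1 := mul_inv_cancel₀ hτ₀.ne'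
  rw [ge_iff_le, one_div, div_eq_mul_inv (1 + ε) τ, Real.rpow_neg hτ₀.le,
    ← Real.inv_rpow hτ₀.le, div_mul_eq_mul_div, mul_div_assoc]
  refine le_min ?_ ?_
  · refine le_trans (mul_le_mul_of_nonneg_left ?_ hε.le)
      (Real.mul_mul_log_sub_add_one_le_rpow_one_add hx₀ ε)
    rw [Real.log_inv]
    nlinarith [mul_le_mul_of_nonneg_left (Real.log_le_half_sub_inv hτ) hx₀.le]
  · refine le_trans (mul_le_mul_of_nonneg_left ?_ hε.le)
      (Real.mul_mul_log_sub_add_one_le_rpow_one_add hτ₀ ε)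
    have h := Real.add_sq_div_two_le_neg_log_one_sub (y := 1 - τ⁻¹) (by linarith) (by linarith)
    rw [sub_sub_cancel, Real.log_inv, neg_neg] at h
    nlinarith [mul_le_mul_of_nonneg_left h hτ₀.le,
      mul_nonneg (sub_nonneg.mpr hτ) (sq_nonneg (1 - τ⁻¹))]
end

section
/- For all real numbers τ ≥ 1 and ε > 0, τ^{-(1+ε)} - (1+ε)/τ + ε ≥ (ε/2)·(1 - 1/τ)². -/
theorem mul_one_sub_le_one_add_mul_one_sub_rpow {x ε : ℝ} (hx : 0 < x) (hx1 : x ≤ 1)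
    (hε : 0 < ε) : ε * (1 - x) ≤ (1 + ε) * (1 - x ^ ε) := by
  have hpow : x ^ ε ≤ 1 := Real.rpow_le_one hx.le hx1 hε.le
  rcases le_total ε 1 with h | h
  · have hb := rpow_one_add_le_one_add_mul_self (s := x - 1) (by linarith) hε.le h
    rw [add_sub_cancel] at hb
    nlinarith
  · have hle : x ^ ε ≤ x := by
      simpa using Real.rpow_le_rpow_of_exponent_ge hx hx1 h
    nlinarith

theorem half_mul_one_sub_sq_le_rpow_one_add {x ε : ℝ} (hx : 0 < x) (hx1 : x ≤ 1)
    (hε : 0 < ε) : ε / 2 * (1 - x) ^ 2 ≤ x ^ (1 + ε) - (1 + ε) * x + ε := by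
  let g : ℝ → ℝ := fun y ↦ y ^ (1 + ε) - (1 + ε) * y + ε - ε / 2 * (1 - y) ^ 2
  have hg : ∀ y, 0 < y → HasDerivAt g (ε * (1 - y) - (1 + ε) * (1 - y ^ ε)) y := by
    intro y hy
    have h1 := Real.hasDerivAt_rpow_const (x := y) (p := 1 + ε) (Or.inl hy.ne')
    have h2 := (hasDerivAt_id y).const_mul (1 + ε)
    have h3 := ((((hasDerivAt_id y).const_sub 1).pow 2).const_mul (ε / 2))
    refine (((h1.sub h2).add_const ε).sub h3).congr_deriv ?_
    rw [add_sub_cancel_left]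
    simp
    ring
  have hanti : AntitoneOn g (Set.Icc x 1) := by
    refine antitoneOn_of_deriv_nonpos (convex_Icc x 1)
      (fun y hy ↦ (hg y (hx.trans_le hy.1)).continuousAt.continuousWithinAt) ?_ ?_
    all_goals
      intro y hy
      rw [interior_Icc] at hy
      have hy0 : 0 < y := hx.trans hy.1
    · exact (hg y hy0).differentiableAt.differentiableWithinAt
    · rw [(hg y hy0).deriv]
      linarith [mul_one_sub_le_one_add_mul_one_sub_rpow hy0 hy.2.le hε]
  have h := hanti (Set.left_mem_Icc.2 hx1) (Set.right_mem_Icc.2 hx1) hx1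
  simp only [g, Real.one_rpow] at h
  linarith

theorem stmt1 (τ ε : ℝ) (hτ : 1 ≤ τ) (hε : 0 < ε) :
    τ ^ (-(1 + ε)) - (1 + ε) / τ + ε ≥ ε / 2 * (1 - 1 / τ) ^ 2 := by
  have hτ0 : 0 < τ := by linarith
  have h := half_mul_one_sub_sq_le_rpow_one_add (inv_pos.2 hτ0) (inv_le_one_of_one_le₀ hτ) hε
  rwa [Real.inv_rpow hτ0.le, ← Real.rpow_neg hτ0.le, ← div_eq_mul_inv, ← one_div] at h
end

section
/- For all real numbers τ ≥ 1 and ε > 0, the quantity g(τ) = (ε/2)·τ² - τ + τ^{1-ε} - ε/2 is nonnegative. -/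
theorem stmt3 (τ ε : ℝ) (hτ : 1 ≤ τ) (hε : 0 < ε) :
    0 ≤ ε / 2 * τ ^ 2 - τ + τ ^ (1 - ε) - ε / 2 := by
  have hpos : 0 < τ := by linarith
  have hsinh : Real.log τ ≤ (τ - τ⁻¹) / 2 := by
    rw [← Real.sinh_log hpos]
    exact Real.self_le_sinh_iff.2 (Real.log_nonneg hτ)
  have hexp : 1 - ε * Real.log τ ≤ τ ^ (-ε) := by
    rw [Real.rpow_def_of_pos hpos]
    linarith [Real.add_one_le_exp (Real.log τ * -ε)]
  have hrpow : τ ^ (1 - ε) = τ * τ ^ (-ε) := by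
    rw [sub_eq_add_neg, Real.rpow_add hpos, Real.rpow_one]
  have hfactor : ε / 2 * τ ^ 2 - τ + τ ^ (1 - ε) - ε / 2 =
      τ * (ε * ((τ - τ⁻¹) / 2) - 1 + τ ^ (-ε)) := by
    rw [hrpow]
    field_simp
    ring
  rw [hfactor]
  refine mul_nonneg hpos.le ?_
  linarith [mul_le_mul_of_nonneg_left hsinh hε.le]
end

section
/- For all real numbers τ ≥ 1 and ε > 0, the quantity h(τ) = τ^{3+ε} - (1+ε)·τ³ + (ε/2)·τ² + ε·τ - ε/2 is nonnegative. -/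
theorem cubic_le_cube_mul_log {τ : ℝ} (hτ : 1 ≤ τ) :
    τ ^ 3 - τ ^ 2 / 2 - τ + 1 / 2 ≤ τ ^ 3 * Real.log τ := by
  have hlog := Real.le_log_one_add_of_nonneg (sub_nonneg.mpr hτ)
  rw [add_sub_cancel] at hlog
  refine le_trans ?_ (mul_le_mul_of_nonneg_left hlog (by positivity))
  have hpos : 0 < τ - 1 + 2 := by linarith
  rw [← mul_div_assoc, le_div_iff₀ hpos]
  have h : 0 ≤ (τ - 1) ^ 3 * (τ + 1 / 2) :=
    mul_nonneg (pow_nonneg (by linarith) 3) (by linarith)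
  linarith

theorem stmt4 (τ ε : ℝ) (hτ : 1 ≤ τ) (hε : 0 < ε) :
    0 ≤ τ ^ (3 + ε) - (1 + ε) * τ ^ 3 + ε / 2 * τ ^ 2 + ε * τ - ε / 2 := by
  have hpos : 0 < τ := by linarith
  have hsplit : τ ^ (3 + ε) = τ ^ 3 * τ ^ ε := by
    rw [Real.rpow_add hpos]
    norm_cast
  have hexp : 1 + ε * Real.log τ ≤ τ ^ ε := by
    rw [Real.rpow_def_of_pos hpos]
    linarith [Real.add_one_le_exp (Real.log τ * ε)]
  have h₁ := mul_le_mul_of_nonneg_left hexp (pow_nonneg hpos.le 3)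
  have h₂ := mul_le_mul_of_nonneg_left (cubic_le_cube_mul_log hτ) hε.le
  rw [hsplit]
  linarith
end

section
/- For all real numbers ε > 0, τ > 1, and z ≥ 0 such that z ≤ 1/τ or z ≥ τ, one has z^{1+ε} - (1+ε)·z + ε ≥ (ε/2)·(1 - 1/τ)². -/
theorem mul_log_sub_le_rpow {ε z : ℝ} (hz : 0 < z) :
    ε * (z * Real.log z - z + 1) ≤ z ^ (1 + ε) - (1 + ε) * z + ε := by
  have h1 : z ^ (1 + ε) = z * Real.exp (Real.log z * ε) := by
    rw [Real.rpow_add hz, Real.rpow_one, Real.rpow_def_of_pos hz]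
  rw [h1]
  nlinarith [mul_le_mul_of_nonneg_left (Real.add_one_le_exp (Real.log z * ε)) hz.le]

theorem half_sq_le_mul_log_of_le_one {z : ℝ} (hz : 0 < z) (hz1 : z ≤ 1) :
    (1 - z) ^ 2 / 2 ≤ z * Real.log z - z + 1 := by
  have h := Real.sinh_le_self_iff.2 (Real.log_nonpos hz.le hz1)
  rw [Real.sinh_log hz] at h
  have h2 := mul_le_mul_of_nonneg_left h hz.le
  have h3 : z * z⁻¹ = 1 := mul_inv_cancel₀ hz.ne'
  nlinarith

theorem half_sq_le_mul_log_of_one_le {z : ℝ} (hz : 1 ≤ z) :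
    (1 - 1 / z) ^ 2 / 2 ≤ z * Real.log z - z + 1 := by
  have hz0 : 0 < z := by linarith
  have h := Real.le_log_one_add_of_nonneg (sub_nonneg.2 hz)
  rw [add_sub_cancel] at h
  have h2 := mul_le_mul_of_nonneg_left h hz0.le
  have h3 : z * (2 * (z - 1) / (z - 1 + 2)) - z + 1 - (1 - 1 / z) ^ 2 / 2
      = (z - 1) ^ 2 * (2 * z ^ 2 - z - 1) / (2 * z ^ 2 * (z + 1)) := by
    have : z - 1 + 2 ≠ 0 := by linarith
    have : z + 1 ≠ 0 := by linarith
    rw [show z - 1 + 2 = z + 1 by ring]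
    field_simp
    ring
  have h4 : 0 ≤ (z - 1) ^ 2 * (2 * z ^ 2 - z - 1) / (2 * z ^ 2 * (z + 1)) := by
    have : 0 ≤ 2 * z ^ 2 - z - 1 := by nlinarith
    positivity
  linarith

theorem stmt6 (ε τ z : ℝ) (hε : 0 < ε) (hτ : 1 < τ) (hz : 0 ≤ z)
    (hout : z ≤ 1 / τ ∨ τ ≤ z) :
    z ^ (1 + ε) - (1 + ε) * z + ε ≥ ε / 2 * (1 - 1 / τ) ^ 2 := by
  have hτ0 : 0 < τ := by linarith
  have hi0 : 0 < 1 / τ := by positivity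
  have hi1 : 1 / τ < 1 := (div_lt_one hτ0).2 hτ
  rcases hz.eq_or_lt with rfl | hz0
  · rw [Real.zero_rpow (by linarith)]
    have : (1 - 1 / τ) ^ 2 ≤ 1 := by nlinarith
    nlinarith
  · refine le_trans ?_ (mul_log_sub_le_rpow hz0)
    have key : (1 - 1 / τ) ^ 2 / 2 ≤ z * Real.log z - z + 1 := by
      rcases hout with h | h
      · refine le_trans ?_ (half_sq_le_mul_log_of_le_one hz0 (by linarith))
        gcongr
      · refine le_trans ?_ (half_sq_le_mul_log_of_one_le (by linarith))
        have : 1 / z ≤ 1 / τ := one_div_le_one_div_of_le hτ0 h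
        gcongr
    calc ε / 2 * (1 - 1 / τ) ^ 2 = ε * ((1 - 1 / τ) ^ 2 / 2) := by ring
      _ ≤ _ := mul_le_mul_of_nonneg_left key hε.le
end

section
/- Let k ≥ 1 and let c_1, d_1, …, c_k, d_k be reals with 0 = c_1 < d_1 < c_2 < d_2 < ⋯ < c_k < d_k = 1. Define U_0(i) = ∏_{j=1}^{i-1} (1 - c_{j+1})/(1 - d_j) and U_1(i) = ∏_{j=i}^{k-1} d_j/c_{j+1} for i ∈ {1,…,k} (empty products are 1). Let n ≥ 1, let σ ∈ {1,…,k}^n, and let x ∈ [0,1]^n be such that x does not lie in the box ∏_{i=1}^n [c_{σ_i}, d_{σ_i}] (i.e., for some coordinate i, x_i < c_{σ_i} or x_i > d_{σ_i}). Then there exist i ∈ {1,…,n} and j ∈ {1,…,k} with j ≠ σ_i such that (1 - x_i)·U_0(j)/U_0(σ_i) + x_i·U_1(j)/U_1(σ_i) ≥ 1. -/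
/-- Potential `U_0(i) = ∏_{j=1}^{i-1} (1 - c_{j+1})/(1 - d_j)` (empty product is 1). -/
noncomputable def U0 (c d : ℕ → ℝ) (i : ℕ) : ℝ :=
  ∏ j ∈ Finset.Icc 1 (i - 1), (1 - c (j + 1)) / (1 - d j)

/-- Potential `U_1(i) = ∏_{j=i}^{k-1} d_j/c_{j+1}` (empty product is 1). -/
noncomputable def U1 (c d : ℕ → ℝ) (k i : ℕ) : ℝ :=
  ∏ j ∈ Finset.Icc i (k - 1), d j / c (j + 1)

theorem c_nonneg {k : ℕ} {c d : ℕ → ℝ} (hc1 : c 1 = 0)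
    (hcd : ∀ i ∈ Finset.Icc 1 k, c i < d i)
    (hdc : ∀ i ∈ Finset.Icc 1 (k - 1), d i < c (i + 1)) {i : ℕ} (hi : 1 ≤ i) (hik : i ≤ k) :
    0 ≤ c i := by
  induction i, hi using Nat.le_induction with
  | base => exact hc1.ge
  | succ i hi ih =>
    have h1 := hcd i (Finset.mem_Icc.2 ⟨hi, by omega⟩)
    have h2 := hdc i (Finset.mem_Icc.2 ⟨hi, by omega⟩)
    linarith [ih (by omega)]

theorem d_le_one {k : ℕ} {c d : ℕ → ℝ} (hdk : d k = 1)
    (hcd : ∀ i ∈ Finset.Icc 1 k, c i < d i)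
    (hdc : ∀ i ∈ Finset.Icc 1 (k - 1), d i < c (i + 1)) {i : ℕ} (hi : 1 ≤ i) (hik : i ≤ k) :
    d i ≤ 1 := by
  induction hik using Nat.decreasingInduction with
  | self => exact hdk.le
  | of_succ i hik ih =>
    have h1 := hcd (i + 1) (Finset.mem_Icc.2 ⟨by omega, by omega⟩)
    have h2 := hdc i (Finset.mem_Icc.2 ⟨hi, by omega⟩)
    linarith [ih (by omega)]

theorem gap_bounds {k : ℕ} {c d : ℕ → ℝ} (hc1 : c 1 = 0) (hdk : d k = 1)
    (hcd : ∀ i ∈ Finset.Icc 1 k, c i < d i)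
    (hdc : ∀ i ∈ Finset.Icc 1 (k - 1), d i < c (i + 1)) {i : ℕ} (hi : 1 ≤ i) (hik : i < k) :
    0 < d i ∧ d i < c (i + 1) ∧ c (i + 1) < 1 := by
  have h1 := c_nonneg hc1 hcd hdc hi hik.le
  have h2 := hcd i (Finset.mem_Icc.2 ⟨hi, hik.le⟩)
  have h3 := d_le_one hdk hcd hdc (i := i + 1) (by omega) hik
  have h4 := hcd (i + 1) (Finset.mem_Icc.2 ⟨by omega, hik⟩)
  exact ⟨by linarith, hdc i (Finset.mem_Icc.2 ⟨hi, by omega⟩), by linarith⟩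

theorem U0_succ (c d : ℕ → ℝ) {i : ℕ} (hi : 1 ≤ i) :
    U0 c d (i + 1) = U0 c d i * ((1 - c (i + 1)) / (1 - d i)) := by
  obtain ⟨m, rfl⟩ : ∃ m, i = m + 1 := ⟨i - 1, by omega⟩
  simp [U0, Finset.prod_Icc_succ_top, mul_div_mul_comm]

theorem U1_eq_mul_succ (c d : ℕ → ℝ) {k i : ℕ} (hik : i < k) :
    U1 c d k i = d i / c (i + 1) * U1 c d k (i + 1) := by
  have h : i ≤ k - 1 := by omega
  unfold U1
  rw [← Finset.insert_Icc_add_one_left_eq_Icc h, Finset.prod_insert (by simp)]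

theorem U0_pos {k : ℕ} {c d : ℕ → ℝ} (hgap : ∀ i, 1 ≤ i → i < k →
    0 < d i ∧ d i < c (i + 1) ∧ c (i + 1) < 1) {i : ℕ} (hik : i ≤ k) : 0 < U0 c d i := by
  refine Finset.prod_pos fun j hj => ?_
  rw [Finset.mem_Icc] at hj
  obtain ⟨h1, h2, h3⟩ := hgap j hj.1 (by omega)
  exact div_pos (by linarith) (by linarith)

theorem U1_pos {k : ℕ} {c d : ℕ → ℝ} (hgap : ∀ i, 1 ≤ i → i < k →
    0 < d i ∧ d i < c (i + 1) ∧ c (i + 1) < 1) {i : ℕ} (hi : 1 ≤ i) : 0 < U1 c d k i := by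
  refine Finset.prod_pos fun j hj => ?_
  rw [Finset.mem_Icc] at hj
  obtain ⟨h1, h2, h3⟩ := hgap j (by omega) (by omega)
  exact div_pos h1 (by linarith)

theorem one_le_weighted_ratios {a b x : ℝ} (ha0 : 0 < a) (ha1 : a < 1)
    (h : 0 ≤ (b - a) * (x - a)) :
    1 ≤ (1 - x) * ((1 - b) / (1 - a)) + x * (b / a) := by
  have ha : 0 < 1 - a := by linarith
  have key : (1 - x) * ((1 - b) / (1 - a)) + x * (b / a) - 1
      = (b - a) * (x - a) / (a * (1 - a)) := by
    field_simp
    ring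
  have : 0 ≤ (b - a) * (x - a) / (a * (1 - a)) := by positivity
  linarith

theorem stmt9 (k n : ℕ) (c d : ℕ → ℝ) (hk : 1 ≤ k) (hn : 1 ≤ n)
    (hc1 : c 1 = 0) (hdk : d k = 1)
    (hcd : ∀ i ∈ Finset.Icc 1 k, c i < d i)
    (hdc : ∀ i ∈ Finset.Icc 1 (k - 1), d i < c (i + 1))
    (σ : ℕ → ℕ) (hσ : ∀ i ∈ Finset.Icc 1 n, σ i ∈ Finset.Icc 1 k)
    (x : ℕ → ℝ) (hx : ∀ i ∈ Finset.Icc 1 n, 0 ≤ x i ∧ x i ≤ 1)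
    (hout : ∃ i ∈ Finset.Icc 1 n, x i < c (σ i) ∨ d (σ i) < x i) :
    ∃ i ∈ Finset.Icc 1 n, ∃ j ∈ Finset.Icc 1 k, j ≠ σ i ∧
      (1 - x i) * (U0 c d j / U0 c d (σ i)) + x i * (U1 c d k j / U1 c d k (σ i)) ≥ 1 := by
  have hgap : ∀ i, 1 ≤ i → i < k → 0 < d i ∧ d i < c (i + 1) ∧ c (i + 1) < 1 :=
    fun i hi hik => gap_bounds hc1 hdk hcd hdc hi hik
  obtain ⟨i, hi, hout⟩ := hout
  refine ⟨i, hi, ?_⟩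
  obtain ⟨hs1, hsk⟩ := Finset.mem_Icc.1 (hσ i hi)
  obtain ⟨hx0, hx1⟩ := hx i hi
  generalize σ i = s at *
  generalize x i = y at *
  rcases hout with hlt | hlt
  · obtain ⟨m, rfl⟩ : ∃ m, s = m + 1 := ⟨s - 1, by omega⟩
    have hm : 1 ≤ m := by
      rcases Nat.eq_zero_or_pos m with rfl | h
      · simp only [zero_add, hc1] at hlt
        linarith
      · exact h
    obtain ⟨h1, h2, h3⟩ := hgap m hm (by omega)
    have hU0 := U0_pos hgap (i := m) (by omega)
    have hU1 := U1_pos hgap (i := m + 1) (by omega)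
    refine ⟨m, Finset.mem_Icc.2 ⟨hm, by omega⟩, by omega, ?_⟩
    have e0 : U0 c d m / U0 c d (m + 1) = (1 - d m) / (1 - c (m + 1)) := by
      rw [U0_succ c d hm, div_mul_cancel_left₀ hU0.ne', inv_div]
    have e1 : U1 c d k m / U1 c d k (m + 1) = d m / c (m + 1) := by
      rw [U1_eq_mul_succ c d (by omega), mul_div_cancel_right₀ _ hU1.ne']
    rw [e0, e1]
    exact one_le_weighted_ratios (by linarith) h3
      (mul_nonneg_of_nonpos_of_nonpos (by linarith) (by linarith))
  · have hlk : s < k := by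
      refine lt_of_le_of_ne hsk ?_
      rintro rfl
      linarith
    obtain ⟨h1, h2, h3⟩ := hgap s hs1 hlk
    have hU0 := U0_pos hgap (i := s) hsk
    have hU1 := U1_pos hgap (i := s + 1) (by omega)
    refine ⟨s + 1, Finset.mem_Icc.2 ⟨by omega, hlk⟩, by omega, ?_⟩
    have e0 : U0 c d (s + 1) / U0 c d s = (1 - c (s + 1)) / (1 - d s) := by
      rw [U0_succ c d hs1, mul_div_cancel_left₀ _ hU0.ne']
    have e1 : U1 c d k (s + 1) / U1 c d k s = c (s + 1) / d s := by
      rw [U1_eq_mul_succ c d hlk, div_mul_cancel_right₀ hU1.ne', inv_div]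
    rw [e0, e1]
    exact one_le_weighted_ratios h1 (by linarith) (mul_nonneg (by linarith) (by linarith))
end

section
/- Let (Ω, 𝔽, ℙ) be a probability space, let τ > 1 and ε > 0 be reals, let T ≥ 2 be an integer, and let X_1, …, X_T : Ω → ℝ be random variables with values in [0,1] such that: (i) almost surely, for every t < T, if X_t ∈ {0,1} then X_{t+1} = X_t; (ii) almost surely, for every t < T, if X_t ∈ (0,1) then X_{t+1}/X_t ∉ (1/τ, τ); (iii) for every t < T, E[X_{t+1} ∣ σ(X_1,…,X_t)] ≥ X_t almost surely (the sequence is a submartingale with respect to its natural filtration). Suppose E[X_1^{1+ε}] > 0 and T ≥ log(1/E[X_1^{1+ε}]) / log(1 + (ε/2)·(1 - 1/τ)²) + 2. Then ℙ(X_T = 1) ≥ (1/2)·E[X_1^{1+ε}]. -/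
open MeasureTheory

/-- The natural σ-algebra `σ(X_1, …, X_t)` generated by the random variables
`X_1, …, X_t`. -/
def naturalSigma {Ω : Type*} (X : ℕ → Ω → ℝ) (t : ℕ) : MeasurableSpace Ω :=
  ⨆ s ∈ Finset.Icc 1 t, MeasurableSpace.comap (X s) (borel ℝ)

theorem le_rpow_of_le_one {θ y : ℝ} (hθ0 : 0 < θ) (hθ1 : θ ≤ 1) (hy0 : 0 ≤ y) (hy1 : y ≤ 1) :
    1 + (1 + θ) * (y - 1) + θ * (1 + θ) / 2 * (1 - y) ^ 2 ≤ y ^ (1 + θ) := by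
  set g : ℝ → ℝ := fun y ↦
    y ^ (1 + θ) - (1 + (1 + θ) * (y - 1) + θ * (1 + θ) / 2 * (1 - y) ^ 2) with hg
  have hd (x : ℝ) : HasDerivAt g ((1 + θ) * (x ^ θ - 1 + θ * (1 - x))) x := by
    have h1 := Real.hasDerivAt_rpow_const (x := x) (p := 1 + θ) (Or.inr (by linarith))
    have h2 := (hasDerivAt_id x).sub_const 1
    have h3 := ((hasDerivAt_id x).const_sub 1).pow 2
    refine (h1.sub (((h2.const_mul (1 + θ)).const_add 1).add
      (h3.const_mul (θ * (1 + θ) / 2)))).congr_deriv ?_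
    simp
    ring
  have hanti : AntitoneOn g (Set.Icc 0 1) := by
    refine antitoneOn_of_deriv_nonpos (convex_Icc 0 1)
      (fun x _ ↦ (hd x).continuousAt.continuousWithinAt)
      (fun x _ ↦ (hd x).differentiableAt.differentiableWithinAt) fun x hx ↦ ?_
    rw [interior_Icc] at hx
    rw [(hd x).deriv]
    have := rpow_one_add_le_one_add_mul_self (s := x - 1) (by linarith [hx.1]) hθ0.le hθ1
    rw [add_sub_cancel] at this
    exact mul_nonpos_of_nonneg_of_nonpos (by linarith) (by linarith)
  have h := hanti ⟨hy0, hy1⟩ ⟨zero_le_one, le_rfl⟩ hy1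
  simp [hg] at h
  linarith

theorem le_rpow_of_one_le {θ y : ℝ} (hθ0 : 0 < θ) (hy1 : 1 ≤ y) :
    1 + (1 + θ) * (y - 1) + θ * (1 + θ) / 2 * (1 - y⁻¹) ^ 2 ≤ y ^ (1 + θ) := by
  set g : ℝ → ℝ := fun y ↦
    y ^ (1 + θ) - (1 + (1 + θ) * (y - 1) + θ * (1 + θ) / 2 * (1 - y⁻¹) ^ 2) with hg
  have hd (x : ℝ) (hx : 1 ≤ x) :
      HasDerivAt g ((1 + θ) * (x ^ θ - 1 - θ * ((1 - x⁻¹) * (x ^ 2)⁻¹))) x := by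
    have h1 := Real.hasDerivAt_rpow_const (x := x) (p := 1 + θ) (Or.inr (by linarith))
    have h2 := (hasDerivAt_id x).sub_const 1
    have h3 := ((hasDerivAt_inv (show x ≠ 0 by linarith)).const_sub 1).pow 2
    refine (h1.sub (((h2.const_mul (1 + θ)).const_add 1).add
      (h3.const_mul (θ * (1 + θ) / 2)))).congr_deriv ?_
    simp
    ring
  have hmono : MonotoneOn g (Set.Ici 1) := by
    refine monotoneOn_of_deriv_nonneg (convex_Ici 1)
      (fun x hx ↦ (hd x hx).continuousAt.continuousWithinAt)
      (fun x hx ↦ (hd x (interior_subset hx)).differentiableAt.differentiableWithinAt)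
      fun x hx ↦ ?_
    have hx1 : 1 ≤ x := interior_subset hx
    have hx0 : 0 < x := by linarith
    rw [(hd x hx1).deriv]
    have hlog := Real.one_sub_inv_le_log_of_pos hx0
    have hexp : θ * Real.log x + 1 ≤ x ^ θ := by
      rw [Real.rpow_def_of_pos hx0, mul_comm]
      exact Real.add_one_le_exp _
    have hinv : x⁻¹ ≤ 1 := inv_le_one_of_one_le₀ hx1
    have hsq : (x ^ 2)⁻¹ ≤ 1 := inv_le_one_of_one_le₀ (one_le_pow₀ hx1)
    have h1 : (1 - x⁻¹) * (x ^ 2)⁻¹ ≤ Real.log x :=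
      (mul_le_of_le_one_right (by linarith) hsq).trans hlog
    have h2 := mul_le_mul_of_nonneg_left h1 hθ0.le
    exact mul_nonneg (by linarith) (by linarith)
  have h := hmono (Set.self_mem_Ici (a := (1 : ℝ))) hy1 hy1
  simp [hg] at h
  linarith

theorem one_sub_inv_sq_le {τ y : ℝ} (hτ : 1 < τ) (hy : τ ≤ y) :
    (1 - 1 / τ) ^ 2 ≤ (1 - y⁻¹) ^ 2 := by
  have h1 : y⁻¹ ≤ τ⁻¹ := inv_anti₀ (by linarith) hy
  have h2 : τ⁻¹ ≤ 1 := inv_le_one_of_one_le₀ hτ.le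
  rw [one_div]
  exact pow_le_pow_left₀ (by linarith) (by linarith) 2

theorem one_sub_sq_le {τ y : ℝ} (hτ : 1 < τ) (hy : y ≤ 1 / τ) :
    (1 - 1 / τ) ^ 2 ≤ (1 - y) ^ 2 := by
  have h2 : τ⁻¹ ≤ 1 := inv_le_one_of_one_le₀ hτ.le
  rw [one_div] at hy ⊢
  exact pow_le_pow_left₀ (by linarith) (by linarith) 2

/-- Quantitative strict convexity of `y ↦ y ^ (1 + θ)` at `1`, for `θ ≤ 1`. -/
theorem rpow_gap_of_le_one {θ τ y : ℝ} (hτ : 1 < τ) (hθ0 : 0 < θ) (hθ1 : θ ≤ 1) (hy0 : 0 ≤ y)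
    (hy : y ∉ Set.Ioo (1 / τ) τ) :
    1 + (1 + θ) * (y - 1) + θ * (1 + θ) / 2 * (1 - 1 / τ) ^ 2 ≤ y ^ (1 + θ) := by
  have hc : 0 ≤ θ * (1 + θ) / 2 := by positivity
  rcases le_or_gt y (1 / τ) with h | h
  · have hy1 : y ≤ 1 := h.trans (by rw [one_div]; exact inv_le_one_of_one_le₀ hτ.le)
    linarith [le_rpow_of_le_one hθ0 hθ1 hy0 hy1,
      mul_le_mul_of_nonneg_left (one_sub_sq_le hτ h) hc]
  · have hτy : τ ≤ y := le_of_not_gt fun h' ↦ hy ⟨h, h'⟩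
    linarith [le_rpow_of_one_le hθ0 (hτ.le.trans hτy),
      mul_le_mul_of_nonneg_left (one_sub_inv_sq_le hτ hτy) hc]

/-- Quantitative strict convexity of `y ↦ y ^ (1 + θ)` at `1`, for `1 ≤ θ`. -/
theorem rpow_gap_of_one_le {θ τ y : ℝ} (hτ : 1 < τ) (hθ1 : 1 ≤ θ) (hy0 : 0 ≤ y)
    (hy : y ∉ Set.Ioo (1 / τ) τ) :
    1 + (1 + θ) * (y - 1) + θ * (1 - 1 / τ) ^ 2 ≤ y ^ (1 + θ) := by
  have hbern := one_add_mul_self_le_rpow_one_add (s := y - 1) (by linarith) hθ1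
  rw [add_sub_cancel] at hbern
  have hsq : 1 + (1 + θ) * (y - 1) + θ * (1 - y) ^ 2 ≤ y ^ (1 + θ) := by
    rw [Real.rpow_add' hy0 (by linarith), Real.rpow_one]
    nlinarith [mul_le_mul_of_nonneg_left hbern hy0]
  have hle : (1 - 1 / τ) ^ 2 ≤ (1 - y) ^ 2 := by
    rcases le_or_gt y (1 / τ) with h | h
    · exact one_sub_sq_le hτ h
    · have hτy : τ ≤ y := le_of_not_gt fun h' ↦ hy ⟨h, h'⟩
      have hy1 : 1 ≤ y := hτ.le.trans hτy
      have hmul : y * y⁻¹ = 1 := mul_inv_cancel₀ (by linarith)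
      have hinv : 0 < y⁻¹ := inv_pos.2 (by linarith)
      have hinv1 : y⁻¹ ≤ 1 := inv_le_one_of_one_le₀ hy1
      refine (one_sub_inv_sq_le hτ hτy).trans ?_
      rw [show (1 - y) ^ 2 = (y - 1) ^ 2 by ring]
      exact pow_le_pow_left₀ (by linarith) (by nlinarith) 2
  linarith [mul_le_mul_of_nonneg_left hle (show 0 ≤ θ by linarith)]

theorem mul_one_add_div_sq_ge {c W L u : ℝ} (hc : 0 ≤ c) (hu : 0 ≤ u) (hu4 : u ≤ 1 / 4)
    (hL : 0 ≤ L) (hW : 2 ≤ W ∨ L + 4 * u ≤ W) :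
    min 1 (1 / 2 + L / 2) ≤ (1 + c) * (1 + W / (2 * (1 + c))) ^ 2 * (1 / 2 - u) := by
  have hc1 : 0 < 1 + c := by linarith
  have hexpand : (1 + c) * (1 + W / (2 * (1 + c))) ^ 2
      = (1 + c) + W + W ^ 2 / (4 * (1 + c)) := by
    field_simp
    ring
  rcases le_or_gt 2 W with h2 | h2
  · have h4 : 4 ≤ (1 + c) * (1 + W / (2 * (1 + c))) ^ 2 := by
      have : W ≤ (1 + c) + W ^ 2 / (4 * (1 + c)) := by
        rw [← sub_le_iff_le_add', le_div_iff₀ (by positivity)]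
        nlinarith [sq_nonneg (W - 2 * (1 + c))]
      rw [hexpand]
      linarith
    refine (min_le_left _ _).trans ?_
    nlinarith
  · have hW' := hW.resolve_left (not_le.2 h2)
    have hW0 : 0 ≤ W := by linarith
    have hsq : (1 + W / 2) ^ 2 ≤ (1 + c) * (1 + W / (2 * (1 + c))) ^ 2 := by
      have : W ^ 2 / 4 - c ≤ W ^ 2 / (4 * (1 + c)) := by
        rw [le_div_iff₀ (by positivity)]
        nlinarith [mul_nonneg hc (show 0 ≤ 4 - W ^ 2 by nlinarith), sq_nonneg c]
      rw [hexpand]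
      linarith
    refine (min_le_right _ _).trans ?_
    refine le_trans ?_ (mul_le_mul_of_nonneg_right hsq (by linarith))
    have key : 0 ≤ W ^ 2 / 8 + u * (1 - W - W ^ 2 / 4) := by
      rcases le_or_gt 0 (1 - W - W ^ 2 / 4) with h | h
      · positivity
      · nlinarith [sq_nonneg (W - 2), mul_nonneg (sub_nonneg.2 hu4) (neg_nonneg.2 h.le)]
    nlinarith

theorem one_add_mul_pow_ge {c q L M : ℝ} {n : ℕ} (hc : 0 ≤ c) (hq : 1 ≤ q)
    (hn : 2 ≤ n) (hL0 : 0 ≤ L) (hL : L ≤ n * c) (hMn : 1 / M ≤ (1 + c) ^ n) :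
    1 / M * ((1 + c) * (1 + (q - 1) * L / (2 * (1 + c))) ^ 2) ≤ (1 + q * c) ^ (n + 1) := by
  have hc1 : 0 < 1 + c := by linarith
  have hq1 : 0 ≤ q - 1 := by linarith
  have hfac : 1 + q * c = (1 + c) * (1 + (q - 1) * c / (1 + c)) := by
    field_simp
    ring
  have hw : 0 ≤ (q - 1) * c / (1 + c) := by positivity
  have hsq : (1 + (q - 1) * L / (2 * (1 + c))) ^ 2 ≤ (1 + (q - 1) * c / (1 + c)) ^ n := by
    have hn2 : (1 : ℝ) ≤ n / 2 := by
      have : (2 : ℝ) ≤ n := by exact_mod_cast hn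
      linarith
    have hb := one_add_mul_self_le_rpow_one_add (s := (q - 1) * c / (1 + c)) (by linarith) hn2
    have hle : 1 + (q - 1) * L / (2 * (1 + c)) ≤ 1 + n / 2 * ((q - 1) * c / (1 + c)) := by
      have : n / 2 * ((q - 1) * c / (1 + c)) = (q - 1) * (n * c) / (2 * (1 + c)) := by
        field_simp
      rw [this]
      gcongr
    calc _ ≤ ((1 + (q - 1) * c / (1 + c)) ^ ((n : ℝ) / 2)) ^ 2 :=
          pow_le_pow_left₀ (by positivity) (hle.trans hb) 2
      _ = _ := by
          rw [← Real.rpow_natCast, ← Real.rpow_mul (by linarith), ← Real.rpow_natCast]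
          congr 1
          push_cast
          ring
  have hG : 1 + c ≤ 1 + q * c := by nlinarith
  calc 1 / M * ((1 + c) * (1 + (q - 1) * L / (2 * (1 + c))) ^ 2)
      ≤ (1 + c) ^ n * ((1 + q * c) * (1 + (q - 1) * c / (1 + c)) ^ n) := by gcongr
    _ = (1 + q * c) ^ (n + 1) := by
      rw [pow_succ (1 + q * c) n]
      rw [← mul_assoc, mul_right_comm, ← mul_pow, ← hfac]

theorem exists_exponent {ε d M : ℝ} {n : ℕ} (hε : 0 < ε) (hε1 : ε < 1) (hd : 0 ≤ d)
    (hM : 0 < M) (hM1 : M ≤ 1) (hMn : 1 / M ≤ (1 + ε / 2 * d) ^ n) :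
    ∃ θ, ε ≤ θ ∧ θ ≤ 1 ∧ 1 - M / 2 ≤
      (1 + θ * (1 + θ) / 2 * d) ^ (n + 1) * (M ^ ((1 + θ) / (1 + ε)) - M / 2) := by
  have hc : 0 ≤ ε / 2 * d := by positivity
  set c := ε / 2 * d with hcdef
  rcases Nat.lt_or_ge n 2 with hn | hn
  · refine ⟨ε, le_rfl, hε1.le, ?_⟩
    rw [div_self (by linarith), Real.rpow_one]
    have hpow : 2 * (1 + c) ^ n - 1 ≤ (1 + ε * (1 + ε) / 2 * d) ^ (n + 1) := by
      have : 1 + c ≤ 1 + ε * (1 + ε) / 2 * d := by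
        rw [show ε * (1 + ε) / 2 * d = (1 + ε) * c by rw [hcdef]; ring]
        nlinarith
      refine le_trans ?_ (pow_le_pow_left₀ (by linarith) this (n + 1))
      interval_cases n
      · simp; linarith
      · rw [pow_one, one_add_one_eq_two]
        linarith [sq_nonneg c, add_sq 1 c]
    have h1 : 2 * (1 / M) - 1 ≤ (1 + ε * (1 + ε) / 2 * d) ^ (n + 1) := by linarith
    have h2 := mul_le_mul_of_nonneg_right h1 (show 0 ≤ M / 2 by linarith)
    have h3 : (2 * (1 / M) - 1) * (M / 2) = 1 - M / 2 := by field_simp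
    linarith
  · set L := -Real.log M with hLdef
    have hL0 : 0 ≤ L := by linarith [Real.log_nonpos hM.le hM1]
    have hL : L ≤ n * c := by
      have h1 := Real.log_le_log (by positivity) hMn
      rw [one_div, Real.log_inv, Real.log_pow] at h1
      have h2 := Real.log_le_sub_one_of_pos (show 0 < 1 + c by linarith)
      exact h1.trans (mul_le_mul_of_nonneg_left (by linarith) (Nat.cast_nonneg n))
    have hML : 1 - M / 2 ≤ min 1 (1 / 2 + L / 2) := by
      refine le_min (by linarith) ?_
      linarith [Real.log_le_sub_one_of_pos hM]
    suffices h : ∃ θ, ε ≤ θ ∧ θ ≤ 1 ∧ (θ - ε) / (1 + ε) * L ≤ 1 / 4 ∧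
        (2 ≤ (θ * (1 + θ) / ε - 1) * L ∨
          L + 4 * ((θ - ε) / (1 + ε) * L) ≤ (θ * (1 + θ) / ε - 1) * L) by
      obtain ⟨θ, hεθ, hθ1, hu4, hW⟩ := h
      refine ⟨θ, hεθ, hθ1, hML.trans ?_⟩
      set u := (θ - ε) / (1 + ε) * L with hu
      have hu0 : 0 ≤ u := mul_nonneg (div_nonneg (by linarith) (by linarith)) hL0
      set q := θ * (1 + θ) / ε with hq
      have hq1 : 1 ≤ q := by
        rw [hq, le_div_iff₀ hε]
        nlinarith
      have hG : 1 + θ * (1 + θ) / 2 * d = 1 + q * c := by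
        rw [hq, hcdef]
        field_simp
      have hMκ : M * (1 / 2 - u) ≤ M ^ ((1 + θ) / (1 + ε)) - M / 2 := by
        have hexp : M ^ ((1 + θ) / (1 + ε)) = M * Real.exp (-u) := by
          rw [show (1 + θ) / (1 + ε) = 1 + (θ - ε) / (1 + ε) by field_simp; ring,
            Real.rpow_add hM, Real.rpow_one, Real.rpow_def_of_pos hM]
          congr 2
          rw [hu, hLdef]
          ring
        rw [hexp]
        nlinarith [Real.add_one_le_exp (-u)]
      rw [hG]
      calc _ ≤ (1 + c) * (1 + (q - 1) * L / (2 * (1 + c))) ^ 2 * (1 / 2 - u) :=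
            mul_one_add_div_sq_ge hc hu0 hu4 hL0 hW
        _ = 1 / M * ((1 + c) * (1 + (q - 1) * L / (2 * (1 + c))) ^ 2) * (M * (1 / 2 - u)) := by
            field_simp
        _ ≤ (1 + q * c) ^ (n + 1) * (M * (1 / 2 - u)) := by
            refine mul_le_mul_of_nonneg_right
              (one_add_mul_pow_ge hc hq1 hn hL0 hL hMn) ?_
            exact mul_nonneg hM.le (by linarith)
        _ ≤ _ := by
            refine mul_le_mul_of_nonneg_left hMκ ?_
            positivity
    rcases le_or_gt ((1 - ε) / (1 + ε) * L) (1 / 4) with hA | hB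
    · refine ⟨1, hε1.le, le_rfl, hA, Or.inr ?_⟩
      have : 1 + 4 * ((1 - ε) / (1 + ε)) ≤ 1 * (1 + 1) / ε - 1 := by
        rw [← sub_nonneg]
        have : 1 * (1 + 1) / ε - 1 - (1 + 4 * ((1 - ε) / (1 + ε)))
            = 2 * (1 - ε) ^ 2 / (ε * (1 + ε)) := by
          field_simp
          ring
        rw [this]
        positivity
      linarith [mul_le_mul_of_nonneg_right this hL0]
    · have hLpos : 0 < L := by
        rcases hL0.eq_or_lt with h | h
        · rw [← h] at hB
          norm_num at hB
        · exact h
      refine ⟨ε + (1 + ε) / (4 * L), ?_, ?_, le_of_eq ?_, Or.inl ?_⟩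
      · have : 0 ≤ (1 + ε) / (4 * L) := by positivity
        linarith
      · rw [div_mul_eq_mul_div, lt_div_iff₀ (by linarith)] at hB
        have : (1 + ε) / (4 * L) ≤ 1 - ε := by
          rw [div_le_iff₀ (by positivity)]
          linarith
        linarith
      · field_simp
        ring
      · rw [← sub_nonneg]
        have : ((ε + (1 + ε) / (4 * L)) * (1 + (ε + (1 + ε) / (4 * L))) / ε - 1) * L - 2
            = ((ε * L - (1 + ε) / 4) ^ 2 / L + (ε - 1 / 2) ^ 2 + ε / 4) / ε := by
          field_simp
          ring
        rw [this]
        positivity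

theorem two_mul_one_add_pow_sub_one_le {c : ℝ} (hc : 0 ≤ c) (n : ℕ) :
    2 * (1 + c) ^ n - 1 ≤ (1 + 2 * c) ^ n := by
  induction n with
  | zero => norm_num
  | succ n ih =>
    have h1 : 1 ≤ (1 + c) ^ n := one_le_pow₀ (by linarith)
    rw [pow_succ, pow_succ]
    nlinarith [mul_le_mul_of_nonneg_right ih (show 0 ≤ 1 + 2 * c by linarith),
      mul_nonneg hc (sub_nonneg.2 h1)]

/-- An exponent `θ` and a gap `g` for which the growth of `E[X_t ^ (1 + θ)]` forces absorption. -/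
theorem exists_exponent_gap {ε τ M : ℝ} {n : ℕ} (hε : 0 < ε) (hτ : 1 < τ)
    (hM : 0 < M) (hM1 : M ≤ 1) (hMn : 1 / M ≤ (1 + ε / 2 * (1 - 1 / τ) ^ 2) ^ n) :
    ∃ θ g, ε ≤ θ ∧ 0 < g ∧
      (∀ y, 0 ≤ y → y ∉ Set.Ioo (1 / τ) τ → 1 + (1 + θ) * (y - 1) + g ≤ y ^ (1 + θ)) ∧
      1 - M / 2 ≤ (1 + g) ^ (n + 1) * (M ^ ((1 + θ) / (1 + ε)) - M / 2) := by
  have hd : 0 < (1 - 1 / τ) ^ 2 := by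
    have : 1 / τ < 1 := by
      rw [one_div]
      exact inv_lt_one_of_one_lt₀ hτ
    exact pow_pos (by linarith) 2
  rcases lt_or_ge ε 1 with hε1 | hε1
  · obtain ⟨θ, hεθ, hθ1, h⟩ := exists_exponent hε hε1 hd.le hM hM1 hMn
    have hθ0 : 0 < θ := hε.trans_le hεθ
    exact ⟨θ, _, hεθ, by positivity, fun y ↦ rpow_gap_of_le_one hτ hθ0 hθ1, h⟩
  · refine ⟨ε, ε * (1 - 1 / τ) ^ 2, le_rfl, by positivity, fun y ↦ rpow_gap_of_one_le hτ hε1, ?_⟩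
    rw [div_self (by linarith), Real.rpow_one]
    have h1 := two_mul_one_add_pow_sub_one_le
      (show 0 ≤ ε / 2 * (1 - 1 / τ) ^ 2 by positivity) n
    rw [show 2 * (ε / 2 * (1 - 1 / τ) ^ 2) = ε * (1 - 1 / τ) ^ 2 by ring] at h1
    have h2 : (1 + ε * (1 - 1 / τ) ^ 2) ^ n ≤ (1 + ε * (1 - 1 / τ) ^ 2) ^ (n + 1) :=
      pow_le_pow_right₀ (le_add_of_nonneg_right (by positivity)) n.le_succ
    have h3 : 2 * (1 / M) - 1 ≤ (1 + ε * (1 - 1 / τ) ^ 2) ^ (n + 1) := by linarith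
    have h4 := mul_le_mul_of_nonneg_right h3 (show 0 ≤ M / 2 by linarith)
    have h5 : (2 * (1 / M) - 1) * (M / 2) = 1 - M / 2 := by field_simp
    linarith

section Probability

variable {Ω : Type*} {m0 : MeasurableSpace Ω} {μ : Measure Ω}

theorem naturalSigma_le {X : ℕ → Ω → ℝ} (hmeas : ∀ t, Measurable (X t)) (t : ℕ) :
    naturalSigma X t ≤ m0 := by
  refine iSup₂_le fun s _ ↦ ?_
  rw [← BorelSpace.measurable_eq (α := ℝ)]
  exact (hmeas s).comap_le

theorem measurable_naturalSigma (X : ℕ → Ω → ℝ) {t : ℕ} (ht : 1 ≤ t) :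
    Measurable[naturalSigma X t] (X t) := by
  refine measurable_iff_comap_le.2 ?_
  rw [BorelSpace.measurable_eq (α := ℝ)]
  exact le_iSup₂_of_le t (Finset.mem_Icc.2 ⟨ht, le_rfl⟩) le_rfl

theorem integrable_of_mem_Icc [IsFiniteMeasure μ] {f : Ω → ℝ} (hf : Measurable f)
    (h : ∀ᵐ ω ∂μ, f ω ∈ Set.Icc (0 : ℝ) 1) : Integrable f μ := by
  refine Integrable.of_bound hf.aestronglyMeasurable 1 ?_
  filter_upwards [h] with ω hω
  rw [Real.norm_of_nonneg hω.1]
  exact hω.2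

theorem rpow_mem_Icc {x r : ℝ} (hx : x ∈ Set.Icc (0 : ℝ) 1) (hr : 0 ≤ r) :
    x ^ r ∈ Set.Icc (0 : ℝ) 1 :=
  ⟨Real.rpow_nonneg hx.1 r, Real.rpow_le_one hx.1 hx.2 hr⟩

/-- If `Y ≤ μ[Z | m]` and `W ≥ 0` is `m`-measurable, then `E[W Y] ≤ E[W Z]`. -/
theorem integral_mul_le_of_le_condExp [IsFiniteMeasure μ] {m : MeasurableSpace Ω} (hm : m ≤ m0)
    {W Y Z : Ω → ℝ} (hW : Measurable[m] W) (hW0 : 0 ≤ᵐ[μ] W) (hZ : Integrable Z μ)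
    (hWY : Integrable (W * Y) μ) (hWZ : Integrable (W * Z) μ) (h : Y ≤ᵐ[μ] μ[Z | m]) :
    ∫ ω, W ω * Y ω ∂μ ≤ ∫ ω, W ω * Z ω ∂μ := by
  have hpull := condExp_mul_of_stronglyMeasurable_left (μ := μ) hW.stronglyMeasurable hWZ hZ
  calc ∫ ω, W ω * Y ω ∂μ ≤ ∫ ω, (μ[W * Z | m]) ω ∂μ := by
        refine integral_mono_ae hWY integrable_condExp ?_
        filter_upwards [hpull, h, hW0] with ω h1 h2 h3
        rw [h1]
        exact mul_le_mul_of_nonneg_left h2 h3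
    _ = ∫ ω, W ω * Z ω ∂μ := integral_condExp hm

/-- The pointwise inequality behind the growth of `E[X_t ^ (1 + θ)]`. -/
theorem rpow_growth {τ θ g x y : ℝ} (hθ : 0 < θ)
    (hgap : ∀ y, 0 ≤ y → y ∉ Set.Ioo (1 / τ) τ → 1 + (1 + θ) * (y - 1) + g ≤ y ^ (1 + θ))
    (hx : x ∈ Set.Icc (0 : ℝ) 1) (hy : y ∈ Set.Icc (0 : ℝ) 1) (hfix : x = 0 ∨ x = 1 → y = x)
    (htr : x ∈ Set.Ioo (0 : ℝ) 1 → y / x ∉ Set.Ioo (1 / τ) τ) :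
    (1 + g) * x ^ (1 + θ) + (1 + θ) * (x ^ θ * y - x ^ θ * x)
      ≤ y ^ (1 + θ) + g * ({1} : Set ℝ).indicator 1 x := by
  rcases hx.1.eq_or_lt with h0 | h0
  · subst h0
    rw [hfix (Or.inl rfl)]
    simp [Real.zero_rpow (show 1 + θ ≠ 0 by linarith)]
  rcases hx.2.eq_or_lt with h1 | h1
  · subst h1
    rw [hfix (Or.inr rfl)]
    simp
  · have h := hgap (y / x) (div_nonneg hy.1 hx.1) (htr ⟨h0, h1⟩)
    have hxp : 0 < x ^ (1 + θ) := Real.rpow_pos_of_pos h0 _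
    rw [Real.div_rpow hy.1 hx.1, le_div_iff₀ hxp] at h
    have hx1 : x ^ (1 + θ) = x ^ θ * x := by
      rw [add_comm, Real.rpow_add h0, Real.rpow_one]
    have hyx : x ^ (1 + θ) * (y / x) = x ^ θ * y := by
      rw [hx1]
      field_simp
    rw [Set.indicator_of_notMem (by simpa using h1.ne)]
    nlinarith

theorem moment_growth [IsProbabilityMeasure μ] {τ θ g : ℝ} (hθ : 0 < θ)
    (hgap : ∀ y, 0 ≤ y → y ∉ Set.Ioo (1 / τ) τ → 1 + (1 + θ) * (y - 1) + g ≤ y ^ (1 + θ))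
    {Y Z : Ω → ℝ} (hY : Measurable Y) (hZ : Measurable Z)
    {m : MeasurableSpace Ω} (hm : m ≤ m0) (hYm : Measurable[m] Y)
    (hY01 : ∀ᵐ ω ∂μ, Y ω ∈ Set.Icc (0 : ℝ) 1) (hZ01 : ∀ᵐ ω ∂μ, Z ω ∈ Set.Icc (0 : ℝ) 1)
    (hfix : ∀ᵐ ω ∂μ, (Y ω = 0 ∨ Y ω = 1) → Z ω = Y ω)
    (htr : ∀ᵐ ω ∂μ, Y ω ∈ Set.Ioo (0 : ℝ) 1 → Z ω / Y ω ∉ Set.Ioo (1 / τ) τ)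
    (hsub : Y ≤ᵐ[μ] μ[Z | m]) :
    (1 + g) * ∫ ω, Y ω ^ (1 + θ) ∂μ
      ≤ ∫ ω, Z ω ^ (1 + θ) ∂μ + g * μ.real {ω | Y ω = 1} := by
  have hθ1 : 0 ≤ 1 + θ := by linarith
  have hWY : Integrable (fun ω ↦ Y ω ^ θ * Y ω) μ := by
    refine integrable_of_mem_Icc ((hY.pow_const θ).mul hY) ?_
    filter_upwards [hY01] with ω h
    have h' := rpow_mem_Icc h hθ.le
    exact ⟨mul_nonneg h'.1 h.1, mul_le_one₀ h'.2 h.1 h.2⟩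
  have hWZ : Integrable (fun ω ↦ Y ω ^ θ * Z ω) μ := by
    refine integrable_of_mem_Icc ((hY.pow_const θ).mul hZ) ?_
    filter_upwards [hY01, hZ01] with ω h hz
    have h' := rpow_mem_Icc h hθ.le
    exact ⟨mul_nonneg h'.1 hz.1, mul_le_one₀ h'.2 hz.1 hz.2⟩
  have hYp : Integrable (fun ω ↦ Y ω ^ (1 + θ)) μ :=
    integrable_of_mem_Icc (hY.pow_const _) (hY01.mono fun ω h ↦ rpow_mem_Icc h hθ1)
  have hZp : Integrable (fun ω ↦ Z ω ^ (1 + θ)) μ :=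
    integrable_of_mem_Icc (hZ.pow_const _) (hZ01.mono fun ω h ↦ rpow_mem_Icc h hθ1)
  have hset : MeasurableSet[m0] {ω | Y ω = 1} := hY (measurableSet_singleton 1)
  have hindeq : (fun ω ↦ ({1} : Set ℝ).indicator (1 : ℝ → ℝ) (Y ω))
      = {ω | Y ω = 1}.indicator 1 := rfl
  have hind : Integrable (fun ω ↦ ({1} : Set ℝ).indicator (1 : ℝ → ℝ) (Y ω)) μ := by
    rw [hindeq]
    exact (integrable_const (1 : ℝ)).indicator hset
  have hle := integral_mul_le_of_le_condExp (μ := μ) hm (hYm.pow_const θ)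
    (hY01.mono fun ω h ↦ (rpow_mem_Icc h hθ.le).1)
    (integrable_of_mem_Icc hZ hZ01) hWY hWZ hsub
  have hmono := integral_mono_ae
    ((hYp.const_mul (1 + g)).add ((hWZ.sub hWY).const_mul (1 + θ))) (hZp.add (hind.const_mul g))
    (by
      filter_upwards [hY01, hZ01, hfix, htr] with ω h1 h2 h3 h4
      exact rpow_growth hθ hgap h1 h2 h3 h4)
  rw [integral_add' (hYp.const_mul (1 + g)) ((hWZ.sub hWY).const_mul (1 + θ)),
    integral_add' hZp (hind.const_mul g), integral_const_mul, integral_const_mul,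
    integral_const_mul, integral_sub' hWZ hWY, hindeq, integral_indicator_one hset] at hmono
  nlinarith [mul_nonneg hθ1 (sub_nonneg.2 hle)]

theorem one_add_pow_mul_sub_le [IsProbabilityMeasure μ] {τ θ g : ℝ} (hθ : 0 < θ) (hg : 0 ≤ g)
    (hgap : ∀ y, 0 ≤ y → y ∉ Set.Ioo (1 / τ) τ → 1 + (1 + θ) * (y - 1) + g ≤ y ^ (1 + θ))
    {T : ℕ} (hT : 1 ≤ T) {X : ℕ → Ω → ℝ} (hmeas : ∀ t, Measurable (X t))
    (hrange : ∀ t ∈ Finset.Icc 1 T, ∀ᵐ ω ∂μ, X t ω ∈ Set.Icc (0 : ℝ) 1)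
    (hfix : ∀ t, 1 ≤ t → t < T →
      ∀ᵐ ω ∂μ, (X t ω = 0 ∨ X t ω = 1) → X (t + 1) ω = X t ω)
    (htraction : ∀ t, 1 ≤ t → t < T →
      ∀ᵐ ω ∂μ, X t ω ∈ Set.Ioo (0 : ℝ) 1 → X (t + 1) ω / X t ω ∉ Set.Ioo (1 / τ) τ)
    (hsub : ∀ t, 1 ≤ t → t < T → X t ≤ᵐ[μ] μ[X (t + 1) | naturalSigma X t]) :
    (1 + g) ^ (T - 1) * (∫ ω, X 1 ω ^ (1 + θ) ∂μ - μ.real {ω | X T ω = 1})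
      ≤ 1 - μ.real {ω | X T ω = 1} := by
  have hone : ∀ t, 1 ≤ t → t ≤ T → μ.real {ω | X t ω = 1} ≤ μ.real {ω | X T ω = 1} := by
    intro t ht htT
    induction T, htT using Nat.le_induction with
    | base => exact le_rfl
    | succ n hn ih =>
      refine (ih (ht.trans hn) (fun s hs ↦ hrange s ?_) (fun s h1 h2 ↦ hfix s h1 (by omega))
        (fun s h1 h2 ↦ htraction s h1 (by omega)) fun s h1 h2 ↦ hsub s h1 (by omega)).trans ?_
      · exact Finset.Icc_subset_Icc_right n.le_succ hs
      · refine ENNReal.toReal_mono (measure_ne_top _ _) (measure_mono_ae ?_)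
        filter_upwards [hfix n (ht.trans hn) n.lt_succ_self] with ω h h1
        exact (h (Or.inr h1)).trans h1
  have hgrow : ∀ t, 1 ≤ t → t ≤ T →
      (1 + g) ^ (t - 1) * (∫ ω, X 1 ω ^ (1 + θ) ∂μ - μ.real {ω | X T ω = 1})
        ≤ ∫ ω, X t ω ^ (1 + θ) ∂μ - μ.real {ω | X T ω = 1} := by
    intro t ht
    induction t, ht using Nat.le_induction with
    | base => simp
    | succ n hn ih =>
      intro hnT
      have h := moment_growth hθ hgap (hmeas n) (hmeas (n + 1)) (naturalSigma_le hmeas n)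
        (measurable_naturalSigma X hn) (hrange n (Finset.mem_Icc.2 ⟨hn, by omega⟩))
        (hrange (n + 1) (Finset.mem_Icc.2 ⟨by omega, hnT⟩)) (hfix n hn hnT)
        (htraction n hn hnT) (hsub n hn hnT)
      have hpn := mul_le_mul_of_nonneg_left (hone n hn (by omega)) hg
      have ih' := mul_le_mul_of_nonneg_left (ih (by omega)) (show 0 ≤ 1 + g by linarith)
      rw [← mul_assoc, ← pow_succ', Nat.sub_add_cancel hn] at ih'
      rw [Nat.add_sub_cancel]
      linarith
  refine (hgrow T hT le_rfl).trans (sub_le_sub_right ?_ _)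
  have h01 := hrange T (Finset.mem_Icc.2 ⟨hT, le_rfl⟩)
  have h := integral_mono_ae (μ := μ) (integrable_of_mem_Icc ((hmeas T).pow_const (1 + θ))
    (h01.mono fun ω h ↦ rpow_mem_Icc h (by linarith))) (integrable_const (1 : ℝ))
    (h01.mono fun ω h ↦ (rpow_mem_Icc h (by linarith)).2)
  simpa using h

theorem rpow_moment_le [IsProbabilityMeasure μ] {Y : Ω → ℝ} (hY : Measurable Y)
    (hY01 : ∀ᵐ ω ∂μ, Y ω ∈ Set.Icc (0 : ℝ) 1) {a b : ℝ} (ha : 0 < a) (hab : a ≤ b) :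
    (∫ ω, Y ω ^ a ∂μ) ^ (b / a) ≤ ∫ ω, Y ω ^ b ∂μ := by
  have hba : 1 ≤ b / a := (one_le_div ha).2 hab
  have heq : ∀ᵐ ω ∂μ, (Y ω ^ a) ^ (b / a) = Y ω ^ b := by
    filter_upwards [hY01] with ω h
    rw [← Real.rpow_mul h.1, mul_div_cancel₀ _ ha.ne']
  have hint (r : ℝ) (hr : 0 ≤ r) : Integrable (fun ω ↦ Y ω ^ r) μ :=
    integrable_of_mem_Icc (hY.pow_const r) (hY01.mono fun ω h ↦ rpow_mem_Icc h hr)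
  have h := (convexOn_rpow hba).map_integral_le (μ := μ) (f := fun ω ↦ Y ω ^ a)
    (Real.continuous_rpow_const (by linarith)).continuousOn isClosed_Ici
    (hY01.mono fun ω h ↦ (rpow_mem_Icc h ha.le).1) (hint a ha.le)
    ((hint b (by linarith)).congr (heq.mono fun ω h ↦ h.symm))
  rwa [integral_congr_ae heq] at h

end Probability

theorem stmt15 {Ω : Type*} {m0 : MeasurableSpace Ω} (μ : Measure Ω)
    [IsProbabilityMeasure μ]
    (τ ε : ℝ) (hτ : 1 < τ) (hε : 0 < ε)
    (T : ℕ) (hT2 : 2 ≤ T)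
    (X : ℕ → Ω → ℝ) (hmeas : ∀ t, Measurable (X t))
    (hrange : ∀ t ∈ Finset.Icc 1 T, ∀ᵐ ω ∂μ, X t ω ∈ Set.Icc (0 : ℝ) 1)
    (hfix : ∀ t, 1 ≤ t → t < T →
      ∀ᵐ ω ∂μ, (X t ω = 0 ∨ X t ω = 1) → X (t + 1) ω = X t ω)
    (htraction : ∀ t, 1 ≤ t → t < T →
      ∀ᵐ ω ∂μ, X t ω ∈ Set.Ioo (0 : ℝ) 1 →
        X (t + 1) ω / X t ω ∉ Set.Ioo (1 / τ) τ)
    (hsub : ∀ t, 1 ≤ t → t < T →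
      X t ≤ᵐ[μ] μ[X (t + 1) | naturalSigma X t])
    (hpos : 0 < ∫ ω, X 1 ω ^ (1 + ε) ∂μ)
    (hTbound : (T : ℝ) ≥ Real.log (1 / ∫ ω, X 1 ω ^ (1 + ε) ∂μ) /
        Real.log (1 + ε / 2 * (1 - 1 / τ) ^ 2) + 2) :
    (μ {ω | X T ω = 1}).toReal ≥ 1 / 2 * ∫ ω, X 1 ω ^ (1 + ε) ∂μ := by
  set M := ∫ ω, X 1 ω ^ (1 + ε) ∂μ with hMdef
  have h01 := hrange 1 (Finset.mem_Icc.2 ⟨le_rfl, by omega⟩)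
  have hM1 : M ≤ 1 := by
    have h := integral_mono_ae (μ := μ) (integrable_of_mem_Icc ((hmeas 1).pow_const (1 + ε))
      (h01.mono fun ω h ↦ rpow_mem_Icc h (by linarith))) (integrable_const (1 : ℝ))
      (h01.mono fun ω h ↦ (rpow_mem_Icc h (by linarith)).2)
    simpa using h
  obtain ⟨n, rfl⟩ : ∃ n, T = n + 2 := ⟨T - 2, by omega⟩
  have hc : 0 < ε / 2 * (1 - 1 / τ) ^ 2 := by
    have : 1 / τ < 1 := by
      rw [one_div]
      exact inv_lt_one_of_one_lt₀ hτ
    exact mul_pos (by linarith) (pow_pos (by linarith) 2)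
  have hMn : 1 / M ≤ (1 + ε / 2 * (1 - 1 / τ) ^ 2) ^ n := by
    have hlog : 0 < Real.log (1 + ε / 2 * (1 - 1 / τ) ^ 2) := Real.log_pos (by linarith)
    have h : Real.log (1 / M) / Real.log (1 + ε / 2 * (1 - 1 / τ) ^ 2) ≤ n := by
      push_cast at hTbound
      linarith
    rw [div_le_iff₀ hlog, ← Real.log_pow] at h
    exact (Real.log_le_log_iff (by positivity) (by positivity)).1 h
  obtain ⟨θ, g, hεθ, hg, hgap, hnum⟩ := exists_exponent_gap hε hτ hpos hM1 hMn
  have hbound := one_add_pow_mul_sub_le (hε.trans_le hεθ) hg.le hgap (by omega) hmeas hrange hfix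
    htraction hsub
  have hmom := rpow_moment_le (hmeas 1) h01 (show 0 < 1 + ε by linarith)
    (show 1 + ε ≤ 1 + θ by linarith)
  rw [← hMdef] at hmom
  rw [show n + 2 - 1 = n + 1 by omega] at hbound
  have hK : 1 < (1 + g) ^ (n + 1) := one_lt_pow₀ (by linarith) n.succ_ne_zero
  change 1 / 2 * M ≤ μ.real {ω | X (n + 2) ω = 1}
  have hmom' := mul_le_mul_of_nonneg_left hmom (zero_le_one.trans hK.le)
  by_contra! hlt
  linarith [mul_pos (sub_pos.2 hK) (sub_pos.2 hlt)]
end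

section
/- Let k ≥ 1 and L ≥ 1 be integers, let z ∈ {0,1}^k, and let R = {0,1}^k \ {z}. Let x^1, …, x^L ∈ R. For each coordinate i ∈ {1,…,k}, let w_i = |{ l ∈ {1,…,L} : x^l_i = 1 }| / L, and suppose that for every i, either w_i < 1/k or w_i > 1 - 1/k. Define y ∈ {0,1}^k by y_i = 0 if w_i < 1/k and y_i = 1 if w_i > 1 - 1/k. Then y ∈ R, i.e., y ≠ z. -/
theorem stmt17 (k L : ℕ) (hk : 1 ≤ k) (hL : 1 ≤ L)
    (z : Fin k → Bool) (x : Fin L → Fin k → Bool)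
    (hx : ∀ l, x l ≠ z)
    (w : Fin k → ℝ)
    (hw : ∀ i, w i = ((Finset.univ.filter fun l => x l i = true).card : ℝ) / L)
    (hE : ∀ i, w i < 1 / k ∨ 1 - 1 / k < w i)
    (y : Fin k → Bool)
    (hy : ∀ i, (w i < 1 / k → y i = false) ∧ (1 - 1 / k < w i → y i = true)) :
    y ≠ z := by
  rintro rfl
  have hL0 : (0 : ℝ) < L := by exact_mod_cast hL
  have disagree_lt : ∀ i,
      ((Finset.univ.filter fun l => x l i ≠ y i).card : ℝ) < L / k := by
    intro i
    rcases hE i with h | h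
    · have hyi := (hy i).1 h
      rw [hw i, div_lt_iff₀ hL0] at h
      simp only [hyi, ne_eq, Bool.not_eq_false]
      rwa [one_div_mul_eq_div] at h
    · have hyi := (hy i).2 h
      have hcard := Finset.card_filter_add_card_filter_not
        (s := (Finset.univ : Finset (Fin L))) (fun l => x l i = true)
      rw [Finset.card_univ, Fintype.card_fin] at hcard
      have hcard' : ((Finset.univ.filter fun l => x l i = true).card : ℝ) +
          (Finset.univ.filter fun l => ¬ x l i = true).card = L := by exact_mod_cast hcard
      rw [hw i, lt_div_iff₀ hL0, sub_mul, one_mul, one_div_mul_eq_div] at h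
      simp only [hyi, ne_eq]
      linarith
  have cover : (Finset.univ : Finset (Fin L)) ⊆
      Finset.univ.biUnion fun i => Finset.univ.filter fun l => x l i ≠ y i := by
    intro l _
    simpa using Function.ne_iff.mp (hx l)
  have hle : L ≤ ∑ i, (Finset.univ.filter fun l => x l i ≠ y i).card := by
    simpa only [Finset.card_univ, Fintype.card_fin] using
      (Finset.card_le_card cover).trans Finset.card_biUnion_le
  have hlt : ∑ i, ((Finset.univ.filter fun l => x l i ≠ y i).card : ℝ) <
      ∑ _i : Fin k, (L / k : ℝ) :=
    Finset.sum_lt_sum_of_nonempty ⟨⟨0, hk⟩, Finset.mem_univ _⟩ fun i _ => disagree_lt i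
  have hk0 : (k : ℝ) ≠ 0 := by exact_mod_cast Nat.one_le_iff_ne_zero.mp hk
  rw [Finset.sum_const, Finset.card_univ, Fintype.card_fin, nsmul_eq_mul,
    mul_div_cancel₀ _ hk0] at hlt
  exact absurd hle (not_le.mpr (by exact_mod_cast hlt))
end
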